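/- arXiv:1604.01657 — 2 statements merged into one kernel-verified Lean document; each statement's English description precedes it below -/
import Mathlib

section
/- Fix Δ ∈ N. Consider the equivalence relation on Z^d generated by: a ∼ b iff |a| = |b| and min(|a−b|,|a+b|) ≤ Δ. Then the diameter (in the pseudo-metric [a−b] = min(|a−b|,|a+b|)) of every equivalence class is bounded by C Δ^{(d+1)!/2}, where C depends only on d. -/
/-- Euclidean norm of an integer vector in `ℤ^d`. -/
noncomputable def znorm {d : ℕ} (a : Fin d → ℤ) : ℝ :=
  Real.sqrt (∑ i, ((a i : ℝ)) ^ 2)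

/-- The pseudo-metric `[a-b] = min(|a-b|, |a+b|)` on `ℤ^d`. -/
noncomputable def pd {d : ℕ} (a b : Fin d → ℤ) : ℝ :=
  min (znorm (a - b)) (znorm (a + b))

lemma abs_dot_le {d : ℕ} (x y : Fin d → ℝ) (W : ℝ) (hW : ∀ i, |y i| ≤ W) :
    |x ⬝ᵥ y| ≤ d * (‖x‖ * W) := by
  unfold dotProduct
  calc |∑ i, x i * y i| ≤ ∑ i, |x i * y i| := Finset.abs_sum_le_sum_abs _ _
    _ ≤ ∑ i : Fin d, ‖x‖ * W := by
        apply Finset.sum_le_sum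
        intro i _
        rw [abs_mul]
        exact mul_le_mul (norm_le_pi_norm x i) (hW i) (abs_nonneg _) (norm_nonneg _)
    _ = d * (‖x‖ * W) := by simp

lemma norm_sq_le_dot {d : ℕ} (x : Fin d → ℝ) : ‖x‖ ^ 2 ≤ x ⬝ᵥ x := by
  have h0 : 0 ≤ x ⬝ᵥ x := Finset.sum_nonneg fun i _ => mul_self_nonneg _
  have : ‖x‖ ≤ Real.sqrt (x ⬝ᵥ x) := by
    rw [pi_norm_le_iff_of_nonneg (Real.sqrt_nonneg _)]
    intro i
    apply Real.le_sqrt_of_sq_le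
    rw [Real.norm_eq_abs, sq_abs, sq]
    exact Finset.single_le_sum (f := fun i => x i * x i)
      (fun i _ => mul_self_nonneg _) (Finset.mem_univ i)
  calc ‖x‖ ^ 2 ≤ (Real.sqrt (x ⬝ᵥ x)) ^ 2 := by gcongr
    _ = _ := Real.sq_sqrt h0

lemma abs_det_le {d : ℕ} (A : Matrix (Fin d) (Fin d) ℝ) (w : Fin d → ℝ)
    (h : ∀ i j, |A i j| ≤ w i) : |A.det| ≤ d.factorial * ∏ i, w i := by
  rw [Matrix.det_apply]
  calc _ ≤ ∑ σ : Equiv.Perm (Fin d), |Equiv.Perm.sign σ • ∏ i, A (σ i) i| :=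
        Finset.abs_sum_le_sum_abs _ _
    _ ≤ ∑ σ : Equiv.Perm (Fin d), ∏ i, w i := by
        apply Finset.sum_le_sum
        intro σ _
        have h1 : |Equiv.Perm.sign σ • ∏ i, A (σ i) i| = ∏ i, |A (σ i) i| := by
          rcases Int.units_eq_one_or (Equiv.Perm.sign σ) with h | h <;>
            simp [h, Finset.abs_prod]
        rw [h1, ← Equiv.prod_comp σ w]
        exact Finset.prod_le_prod (fun i _ => abs_nonneg _) (fun i _ => h _ _)
    _ = _ := by simp [Fintype.card_perm]

def IsInt {d : ℕ} (v : Fin d → ℝ) : Prop := ∀ i, ∃ m : ℤ, v i = m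

lemma one_le_abs_det {d : ℕ} (A : Matrix (Fin d) (Fin d) ℝ) (h : ∀ i, IsInt (A i))
    (h0 : A.det ≠ 0) : 1 ≤ |A.det| := by
  choose m hm using h
  have : A = (Matrix.of m).map (Int.castRingHom ℝ) := by
    ext i j; simp [hm]
  have h2 : A.det = (((Matrix.of m).det : ℤ) : ℝ) := by
    rw [this, ← RingHom.mapMatrix_apply, ← RingHom.map_det]; rfl
  rw [h2] at h0 ⊢
  exact_mod_cast Int.one_le_abs (by exact_mod_cast h0)

lemma key {d : ℕ} (S : Set (Fin d → ℝ)) (u : Fin d → ℝ) (ρ : ℝ) (hρ : 1 ≤ ρ)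
    (hSint : ∀ v ∈ S, IsInt v) (hS : ∀ v ∈ S, ‖v‖ ≤ ρ) (hu : ∀ v ∈ S, v ⬝ᵥ v = v ⬝ᵥ u)
    (z : Fin d → ℝ) (hz : z ∈ Submodule.span ℝ S) (hzu : z ⬝ᵥ z = z ⬝ᵥ u) :
    ‖z‖ ≤ d * (d * ρ * (d.factorial * ρ ^ (Module.finrank ℝ (Submodule.span ℝ S)))) := by
  obtain ⟨b0, hb0S, hspan, hli⟩ := exists_linearIndependent ℝ S
  obtain ⟨b, hbt, hb0b, htb, hbli⟩ := exists_linearIndepOn_id_extension (K := ℝ) (s := b0)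
    (t := b0 ∪ Set.range (fun i : Fin d => (Pi.single i 1 : Fin d → ℝ))) hli Set.subset_union_left
  have hbli' : LinearIndependent ℝ ((↑) : b → (Fin d → ℝ)) := hbli
  have htop : ⊤ ≤ Submodule.span ℝ (Set.range ((↑) : b → (Fin d → ℝ))) := by
    rw [Subtype.range_coe, ← (Pi.basisFun ℝ (Fin d)).span_eq, Submodule.span_le]
    rintro _ ⟨i, rfl⟩
    apply htb
    right
    exact ⟨i, by simp [Pi.basisFun_apply]⟩
  let B := Module.Basis.mk hbli' htop
  have : Finite b := hbli'.finite
  have : Fintype b := Fintype.ofFinite b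
  have hcard : Fintype.card (Fin d) = Fintype.card b := by
    rw [← Module.finrank_eq_card_basis B]; simp
  let e : Fin d ≃ b := Fintype.equivOfCardEq hcard
  classical
  let A : Matrix (Fin d) (Fin d) ℝ := Matrix.of fun j => (e j : Fin d → ℝ)
  have hAli : LinearIndependent ℝ A.row := hbli'.comp e e.injective
  have hdet : A.det ≠ 0 := by
    have := Matrix.linearIndependent_rows_iff_isUnit.1 hAli
    exact ((Matrix.isUnit_iff_isUnit_det A).1 this).ne_zero
  have hmem : ∀ j, (e j : Fin d → ℝ) ∈ b0 ∨ ∃ i : Fin d, (Pi.single i 1 : Fin d → ℝ) = e j :=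
    fun j => hbt (e j).2
  have hdet1 : 1 ≤ |A.det| := by
    apply one_le_abs_det _ _ hdet
    intro j
    rcases hmem j with h | ⟨i, h⟩
    · exact hSint _ (hb0S h)
    · intro l
      change ∃ m : ℤ, (e j : Fin d → ℝ) l = m
      rw [← h]
      by_cases hl : l = i
      · subst hl; exact ⟨1, by simp⟩
      · exact ⟨0, by simp [hl]⟩
  let w : Fin d → ℝ := fun j => if (e j : Fin d → ℝ) ∈ b0 then ρ else 1
  have hAw : ∀ j l, |A j l| ≤ w j := by
    intro j l
    change |(e j : Fin d → ℝ) l| ≤ if (e j : Fin d → ℝ) ∈ b0 then ρ else 1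
    split_ifs with h
    · exact (norm_le_pi_norm (e j : Fin d → ℝ) l).trans (hS _ (hb0S h))
    · rcases hmem j with h' | ⟨i, h'⟩
      · exact absurd h' h
      · rw [← h']
        by_cases hl : l = i
        · subst hl; simp
        · simp [hl]
  have hprod : ∏ j, w j = ρ ^ (Module.finrank ℝ (Submodule.span ℝ S)) := by
    have h1 : ∏ j, w j = ∏ v : b, if (v : Fin d → ℝ) ∈ b0 then ρ else 1 :=
      Equiv.prod_comp e (fun v : b => if (v : Fin d → ℝ) ∈ b0 then ρ else 1)
    rw [h1, Finset.prod_ite, Finset.prod_const, Finset.prod_const_one, mul_one]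
    have hf0 : Finite b0 := hli.finite
    have hf1 : Fintype b0 := Fintype.ofFinite _
    rw [← hspan, finrank_span_set_eq_card hli, Set.toFinset_card, ← Fintype.card_subtype]
    let f : {x : b // (x : Fin d → ℝ) ∈ b0} ≃ b0 :=
      ⟨fun x => ⟨x.1.1, x.2⟩, fun y => ⟨⟨y.1, hb0b y.2⟩, y.2⟩, fun x => rfl, fun y => rfl⟩
    rw [Fintype.card_congr f]
  by_cases hd : d = 0
  · subst hd
    have : z = 0 := Subsingleton.elim _ _
    simp [this]
  have hd1 : (1 : ℝ) ≤ d := by exact_mod_cast Nat.one_le_iff_ne_zero.2 hd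
  have hdρ : 0 < (d : ℝ) * ρ := by positivity
  let c : Fin d → ℝ := fun j => if (e j : Fin d → ℝ) ∈ b0 then ((e j : Fin d → ℝ) ⬝ᵥ u) / (d * ρ) else 0
  have hcw : ∀ j, |c j| ≤ w j := by
    intro j
    change |if (e j : Fin d → ℝ) ∈ b0 then ((e j : Fin d → ℝ) ⬝ᵥ u) / (d * ρ) else 0| ≤
      if (e j : Fin d → ℝ) ∈ b0 then ρ else 1
    split_ifs with h
    · have hn := hS _ (hb0S h)
      rw [← hu _ (hb0S h), abs_div, abs_of_pos hdρ, div_le_iff₀ hdρ]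
      calc _ ≤ (d : ℝ) * (‖(e j : Fin d → ℝ)‖ * ρ) :=
            abs_dot_le _ _ _ fun i => (norm_le_pi_norm (e j : Fin d → ℝ) i).trans hn
        _ ≤ d * (ρ * ρ) := by gcongr
        _ = _ := by ring
    · simp
  let y : Fin d → ℝ := A.cramer c
  have hy : ∀ i, |y i| ≤ d.factorial * ∏ j, w j := by
    intro i
    change |A.cramer c i| ≤ _
    rw [Matrix.cramer_apply]
    apply abs_det_le
    intro j l
    rw [Matrix.updateCol_apply]
    split_ifs
    · exact hcw j
    · exact hAw j l
  have hAy : ∀ v ∈ b0, v ⬝ᵥ y = A.det * ((v ⬝ᵥ u) / (d * ρ)) := by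
    intro v hv
    have h1 := congrFun (Matrix.mulVec_cramer A c) (e.symm ⟨v, hb0b hv⟩)
    have h2 : A (e.symm ⟨v, hb0b hv⟩) = v := by
      change ((e (e.symm ⟨v, hb0b hv⟩) : b) : Fin d → ℝ) = v
      simp
    have h3 : c (e.symm ⟨v, hb0b hv⟩) = (v ⬝ᵥ u) / (d * ρ) := by
      simp [c, hv]
    rw [Pi.smul_apply, h3, smul_eq_mul] at h1
    rw [← h1]
    change v ⬝ᵥ y = A (e.symm ⟨v, hb0b hv⟩) ⬝ᵥ y
    rw [h2]
  have hAz : z ⬝ᵥ y = A.det * ((z ⬝ᵥ u) / (d * ρ)) := by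
    have hall : ∀ x ∈ Submodule.span ℝ b0, x ⬝ᵥ y = A.det * ((x ⬝ᵥ u) / (d * ρ)) := by
      intro x hx
      induction hx using Submodule.span_induction with
      | mem x h => exact hAy x h
      | zero => simp
      | add a b _ _ ha hb =>
        rw [add_dotProduct, add_dotProduct, ha, hb]; ring
      | smul a x _ hx =>
        rw [smul_dotProduct, smul_dotProduct, hx, smul_eq_mul, smul_eq_mul]; ring
    exact hall z (hspan ▸ hz)
  have hWn : 0 ≤ (d.factorial : ℝ) * ∏ j, w j := by rw [hprod]; positivity
  have h5 := abs_dot_le z y _ hy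
  rw [hAz, ← hzu, abs_mul, abs_div, abs_of_pos hdρ] at h5
  have h6 : ‖z‖ ^ 2 ≤ |z ⬝ᵥ z| := (norm_sq_le_dot z).trans (le_abs_self _)
  have h7 : ‖z‖ ^ 2 / (d * ρ) ≤ d * (‖z‖ * (d.factorial * ∏ j, w j)) := by
    calc ‖z‖ ^ 2 / (d * ρ) ≤ 1 * (|z ⬝ᵥ z| / (d * ρ)) := by rw [one_mul]; gcongr
      _ ≤ |A.det| * (|z ⬝ᵥ z| / (d * ρ)) := by gcongr
      _ ≤ _ := h5
  rw [div_le_iff₀ hdρ] at h7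
  rw [← hprod]
  rcases (norm_nonneg z).eq_or_lt with h | h
  · rw [← h]; positivity
  · apply le_of_mul_le_mul_left _ h
    linarith

/-- The span of the first points of a chain. -/
def csp {d : ℕ} (z : ℕ → Fin d → ℝ) (N : ℕ) : Submodule ℝ (Fin d → ℝ) :=
  Submodule.span ℝ (z '' {i | i ≤ N})

lemma csp_mono {d : ℕ} (z : ℕ → Fin d → ℝ) {M N : ℕ} (h : M ≤ N) : csp z M ≤ csp z N :=
  Submodule.span_mono (Set.image_mono fun _ hi => le_trans hi h)

lemma mem_csp {d : ℕ} (z : ℕ → Fin d → ℝ) {i N : ℕ} (h : i ≤ N) : z i ∈ csp z N :=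
  Submodule.subset_span ⟨i, h, rfl⟩

/-- A chain of integer vectors with steps bounded by `Δ`, on a sphere through the origin. -/
structure IsCh {d : ℕ} (u : Fin d → ℝ) (Δ : ℝ) (z : ℕ → Fin d → ℝ) (N : ℕ) : Prop where
  zero : z 0 = 0
  int : ∀ i ≤ N, IsInt (z i)
  sph : ∀ i ≤ N, z i ⬝ᵥ z i = z i ⬝ᵥ u
  step : ∀ i < N, ‖z (i + 1) - z i‖ ≤ Δ

lemma IsCh.mono {d : ℕ} {u : Fin d → ℝ} {Δ : ℝ} {z : ℕ → Fin d → ℝ} {M N : ℕ}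
    (h : IsCh u Δ z N) (hM : M ≤ N) : IsCh u Δ z M :=
  ⟨h.zero, fun i hi => h.int i (hi.trans hM), fun i hi => h.sph i (hi.trans hM),
    fun i hi => h.step i (hi.trans_le hM)⟩

lemma base_case {d : ℕ} {u : Fin d → ℝ} {Δ : ℝ} {z : ℕ → Fin d → ℝ} {N : ℕ} (hΔ : 0 ≤ Δ)
    (h : IsCh u Δ z N) (hr : Module.finrank ℝ (csp z N) ≤ 1) : ‖z N‖ ≤ Δ := by
  classical
  by_cases hN : z N = 0
  · simpa [hN] using hΔ
  have hex : ∃ k, z k ≠ 0 := ⟨N, hN⟩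
  obtain ⟨k, hk, hmin⟩ : ∃ k, z k ≠ 0 ∧ ∀ m < k, z m = 0 :=
    ⟨Nat.find hex, Nat.find_spec hex, fun m hm => not_not.1 (Nat.find_min hex hm)⟩
  have hkN : k ≤ N := by
    by_contra hc
    exact hN (hmin N (by omega))
  have hk0 : k ≠ 0 := fun h0 => hk (h0 ▸ h.zero)
  obtain ⟨j, rfl⟩ := Nat.exists_eq_succ_of_ne_zero hk0
  have hkn : ‖z (j + 1)‖ ≤ Δ := by
    have := h.step j (by omega)
    rwa [hmin j (by omega), sub_zero] at this
  have hline : ∃ t : ℝ, z N = t • z (j + 1) := by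
    have h1 : Submodule.span ℝ {z (j + 1)} ≤ csp z N := by
      rw [Submodule.span_singleton_le_iff_mem]; exact mem_csp z hkN
    have h2 : Submodule.span ℝ {z (j + 1)} = csp z N := by
      apply Submodule.eq_of_le_of_finrank_le h1
      rw [finrank_span_singleton hk]; exact hr
    have h3 : z N ∈ Submodule.span ℝ {z (j + 1)} := h2 ▸ mem_csp z le_rfl
    obtain ⟨t, ht⟩ := Submodule.mem_span_singleton.1 h3
    exact ⟨t, ht.symm⟩
  obtain ⟨t, ht⟩ := hline
  have e1 := h.sph N le_rfl
  have e2 := h.sph (j + 1) hkN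
  have hpos : 0 < z (j + 1) ⬝ᵥ z (j + 1) := by
    have := norm_sq_le_dot (z (j + 1))
    have h' : 0 < ‖z (j + 1)‖ := norm_pos_iff.2 hk
    have : 0 < ‖z (j + 1)‖ ^ 2 := by positivity
    linarith
  rw [ht] at e1
  simp only [smul_dotProduct, dotProduct_smul, smul_eq_mul] at e1
  rw [← e2] at e1
  have ht0 : t ≠ 0 := by
    rintro rfl
    exact hN (by simpa using ht)
  have ht1 : t = 1 := by
    have := mul_left_cancel₀ ht0 e1
    exact mul_right_cancel₀ hpos.ne' (by linarith)
  rw [ht, ht1, one_smul]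
  exact hkn

lemma main_ind (d n : ℕ) : ∃ (C : ℝ) (E : ℕ), 1 ≤ C ∧ 1 ≤ E ∧ 2 * E = (n + 2).factorial ∧
    ∀ (u : Fin d → ℝ) (Δ : ℝ) (z : ℕ → Fin d → ℝ) (N : ℕ), 1 ≤ Δ → IsCh u Δ z N →
      Module.finrank ℝ (csp z N) ≤ n + 1 → ‖z N‖ ≤ C * Δ ^ E := by
  induction n with
  | zero =>
    refine ⟨1, 1, le_rfl, le_rfl, rfl, ?_⟩
    intro u Δ z N hΔ h hr
    simpa using base_case (by linarith) h hr
  | succ n ih =>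
    obtain ⟨C, E, hC, hE, hEf, ih⟩ := ih
    let K : ℝ := d * (d * (C + 1) * (d.factorial * (C + 1) ^ (n + 2)))
    have hK : 0 ≤ K := by positivity
    refine ⟨K + C, (n + 3) * E, by linarith, by nlinarith, ?_, ?_⟩
    · rw [show n + 1 + 2 = (n + 2) + 1 by ring, Nat.factorial_succ, ← hEf]; ring
    intro u Δ z N hΔ h hr
    have hEE : Δ ^ E ≤ Δ ^ ((n + 3) * E) := pow_le_pow_right₀ hΔ (by nlinarith)
    have hP : 0 ≤ Δ ^ ((n + 3) * E) := by positivity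
    by_cases hr' : Module.finrank ℝ (csp z N) ≤ n + 1
    · calc _ ≤ C * Δ ^ E := ih u Δ z N hΔ h hr'
        _ ≤ C * Δ ^ ((n + 3) * E) := by gcongr
        _ ≤ _ := by nlinarith
    classical
    have hex : ∃ k, n + 2 ≤ Module.finrank ℝ (csp z k) := ⟨N, by omega⟩
    obtain ⟨k, hk, hmin⟩ : ∃ k, n + 2 ≤ Module.finrank ℝ (csp z k) ∧
        ∀ m < k, Module.finrank ℝ (csp z m) ≤ n + 1 :=
      ⟨Nat.find hex, Nat.find_spec hex, fun m hm => by
        have := Nat.find_min hex hm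
        omega⟩
    have hkN : k ≤ N := by
      by_contra hc
      exact hr' (hmin N (by omega))
    have hsp : csp z k = csp z N :=
      Submodule.eq_of_le_of_finrank_le (csp_mono z hkN) (by omega)
    have hfr : Module.finrank ℝ (csp z k) = n + 2 := by
      apply le_antisymm _ hk
      rw [hsp]; exact hr
    have hlt : ∀ j < k, ‖z j‖ ≤ C * Δ ^ E := fun j hj =>
      ih u Δ z j hΔ (h.mono (by omega)) (hmin j hj)
    have hΔE : Δ ≤ Δ ^ E := le_self_pow₀ hΔ (by omega)
    let ρ : ℝ := (C + 1) * Δ ^ E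
    have hle : ∀ j ≤ k, ‖z j‖ ≤ ρ := by
      intro j hj
      rcases j with _ | j
      · rw [h.zero, norm_zero]; positivity
      · have h1 := hlt j (by omega)
        have h2 := h.step j (by omega)
        have h3 : ‖z (j + 1)‖ ≤ ‖z (j + 1) - z j‖ + ‖z j‖ := by
          simpa using norm_add_le (z (j + 1) - z j) (z j)
        change _ ≤ (C + 1) * Δ ^ E
        linarith
    have hρ1 : 1 ≤ ρ := by
      have : 1 ≤ Δ ^ E := one_le_pow₀ hΔ
      change 1 ≤ (C + 1) * Δ ^ E
      nlinarith
    have := key (z '' {i | i ≤ k}) u ρ hρ1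
      (by rintro _ ⟨i, hi, rfl⟩; exact h.int i (le_trans hi hkN))
      (by rintro _ ⟨i, hi, rfl⟩; exact hle i hi)
      (by rintro _ ⟨i, hi, rfl⟩; exact h.sph i (le_trans hi hkN))
      (z N) (by
        have : z N ∈ csp z k := hsp ▸ mem_csp z le_rfl
        exact this) (h.sph N le_rfl)
    change _ ≤ (d : ℝ) * (d * ρ * (d.factorial * ρ ^ (Module.finrank ℝ (csp z k)))) at this
    rw [hfr] at this
    have he : (d : ℝ) * (d * ρ * (d.factorial * ρ ^ (n + 2))) = K * Δ ^ ((n + 3) * E) := by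
      simp only [ρ, K]
      rw [mul_comm (n + 3) E, pow_mul, mul_pow]
      ring
    rw [he] at this
    calc _ ≤ _ := this
      _ ≤ _ := by nlinarith

lemma znorm_sq {d : ℕ} (a : Fin d → ℤ) : znorm a ^ 2 = ((∑ i, (a i) ^ 2 : ℤ) : ℝ) := by
  unfold znorm
  rw [Real.sq_sqrt (Finset.sum_nonneg fun i _ => sq_nonneg _)]
  push_cast; rfl

lemma znorm_nonneg {d : ℕ} (a : Fin d → ℤ) : 0 ≤ znorm a := Real.sqrt_nonneg _

lemma znorm_neg {d : ℕ} (a : Fin d → ℤ) : znorm (-a) = znorm a := by simp [znorm]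

lemma norm_le_znorm {d : ℕ} (a : Fin d → ℤ) : ‖(fun i => (a i : ℝ))‖ ≤ znorm a := by
  rw [pi_norm_le_iff_of_nonneg (znorm_nonneg _)]
  intro i
  apply Real.le_sqrt_of_sq_le
  rw [Real.norm_eq_abs, sq_abs]
  exact Finset.single_le_sum (f := fun i => (a i : ℝ) ^ 2)
      (fun i _ => sq_nonneg _) (Finset.mem_univ i)

lemma znorm_le_norm {d : ℕ} (a : Fin d → ℤ) : znorm a ≤ d * ‖(fun i => (a i : ℝ))‖ := by
  have h := abs_dot_le (fun i => (a i : ℝ)) (fun i => (a i : ℝ)) _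
    (fun i => norm_le_pi_norm (fun i => (a i : ℝ)) i)
  apply Real.sqrt_le_iff.2 ⟨by positivity, ?_⟩
  have h2 : ∑ i, (a i : ℝ) ^ 2 = (fun i => (a i : ℝ)) ⬝ᵥ (fun i => (a i : ℝ)) := by
    simp [dotProduct, sq]
  rw [h2]
  refine (le_abs_self _).trans (h.trans ?_)
  rw [mul_pow, sq ‖_‖]
  gcongr
  exact_mod_cast Nat.le_self_pow (by norm_num) d

/-- The pre-relation without the sign. -/
def PR {d : ℕ} (Δ : ℝ) (x y : Fin d → ℤ) : Prop := znorm x = znorm y ∧ znorm (x - y) ≤ Δ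

lemma PR.symm {d : ℕ} {Δ : ℝ} {x y : Fin d → ℤ} (h : PR Δ x y) : PR Δ y x :=
  ⟨h.1.symm, by rw [← neg_sub, znorm_neg]; exact h.2⟩

lemma PR.neg {d : ℕ} {Δ : ℝ} {x y : Fin d → ℤ} (h : PR Δ x y) : PR Δ (-x) (-y) :=
  ⟨by rw [znorm_neg, znorm_neg]; exact h.1, by
    rw [show -x - -y = -(x - y) by abel, znorm_neg]; exact h.2⟩

lemma rtg_neg {d : ℕ} {Δ : ℝ} {x y : Fin d → ℤ} (h : Relation.ReflTransGen (PR Δ) x y) :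
    Relation.ReflTransGen (PR Δ) (-x) (-y) :=
  h.lift (fun x => -x) fun _ _ h => h.neg

lemma rtg_symm {d : ℕ} {Δ : ℝ} {x y : Fin d → ℤ} (h : Relation.ReflTransGen (PR Δ) x y) :
    Relation.ReflTransGen (PR Δ) y x := by
  induction h with
  | refl => exact .refl
  | tail _ h ih => exact .head h.symm ih

lemma eqv_rtg {d : ℕ} {Δ : ℝ} {a b : Fin d → ℤ}
    (h : Relation.EqvGen (fun x y : Fin d → ℤ => znorm x = znorm y ∧ pd x y ≤ Δ) a b) :
    Relation.ReflTransGen (PR Δ) a b ∨ Relation.ReflTransGen (PR Δ) a (-b) := by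
  induction h with
  | rel x y h =>
    rcases min_le_iff.1 h.2 with h2 | h2
    · exact .inl (.single ⟨h.1, h2⟩)
    · exact .inr (.single ⟨by rw [znorm_neg]; exact h.1, by rwa [sub_neg_eq_add]⟩)
  | refl x => exact .inl .refl
  | symm x y _ ih =>
    rcases ih with h | h
    · exact .inl (rtg_symm h)
    · exact .inr (by simpa using rtg_neg (rtg_symm h))
  | trans x y z _ _ ih1 ih2 =>
    rcases ih1 with h | h <;> rcases ih2 with h' | h'
    · exact .inl (h.trans h')
    · exact .inr (h.trans h')
    · exact .inr (h.trans (rtg_neg h'))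
    · exact .inl (h.trans (by simpa using rtg_neg h'))

lemma rtg_seq {α : Type*} {r : α → α → Prop} {a b : α} (h : Relation.ReflTransGen r a b) :
    ∃ (N : ℕ) (z : ℕ → α), z 0 = a ∧ z N = b ∧ ∀ i < N, r (z i) (z (i + 1)) := by
  induction h with
  | refl => exact ⟨0, fun _ => a, rfl, rfl, by simp⟩
  | @tail b c _ hbc ih =>
    obtain ⟨N, z, h0, hN, hs⟩ := ih
    refine ⟨N + 1, fun i => if i ≤ N then z i else c, by simpa using h0, by simp, ?_⟩
    intro i hi
    rcases Nat.lt_or_ge i N with h | h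
    · have h1 : i ≤ N := h.le
      have h2 : i + 1 ≤ N := h
      simp only [h1, h2, if_true]
      exact hs i h
    · have h1 : i = N := by omega
      subst h1
      simpa [hN] using hbc

lemma rtg_bound (d : ℕ) : ∃ C : ℝ, 0 < C ∧ ∀ (Δ : ℕ) (a b : Fin d → ℤ),
    Relation.ReflTransGen (PR (Δ : ℝ)) a b →
      znorm (a - b) ≤ C * (Δ : ℝ) ^ (((d + 1).factorial : ℝ) / 2) := by
  rcases Nat.eq_zero_or_pos d with rfl | hd
  · refine ⟨1, one_pos, fun Δ a b _ => ?_⟩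
    have : znorm (a - b) = 0 := by simp [znorm]
    rw [this]; positivity
  obtain ⟨n, rfl⟩ : ∃ n, d = n + 1 := ⟨d - 1, by omega⟩
  obtain ⟨C, E, hC, hE, hEf, H⟩ := main_ind (n + 1) n
  refine ⟨((n + 1 : ℕ) : ℝ) * C, by positivity, fun Δ a b hab => ?_⟩
  obtain ⟨N, x, h0, hN, hs⟩ := rtg_seq hab
  have hexp : (((n + 1 + 1).factorial : ℝ) / 2) = (E : ℝ) := by
    rw [show n + 1 + 1 = n + 2 by ring, ← hEf]; push_cast; ring
  rw [hexp, Real.rpow_natCast]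
  rcases Nat.eq_zero_or_pos Δ with rfl | hΔ
  · have hx : ∀ i ≤ N, x i = a := by
      intro i
      induction i with
      | zero => intro _; exact h0
      | succ i ih =>
        intro hi
        have h1 := (hs i (by omega)).2
        have h2 := (norm_le_znorm _).trans h1
        rw [ih (by omega)] at h2
        have h3 : ‖(fun j => ((a - x (i + 1)) j : ℝ))‖ = 0 :=
          le_antisymm (by simpa using h2) (norm_nonneg _)
        rw [norm_eq_zero] at h3
        ext j
        have h4 := congrFun h3 j
        simp only [Pi.zero_apply, Int.cast_eq_zero, Pi.sub_apply] at h4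
        omega
    have : a - b = 0 := by rw [← hN, hx N le_rfl, sub_self]
    rw [this]
    have : znorm (0 : Fin (n + 1) → ℤ) = 0 := by simp [znorm]
    rw [this]; positivity
  have hnorm : ∀ i ≤ N, ∑ j, (x i j) ^ 2 = ∑ j, (a j) ^ 2 := by
    intro i
    induction i with
    | zero => intro _; rw [h0]
    | succ i ih =>
      intro hi
      rw [← ih (by omega)]
      have h1 := (hs i (by omega)).1
      have h2 : znorm (x i) ^ 2 = znorm (x (i + 1)) ^ 2 := by rw [h1]
      rw [znorm_sq, znorm_sq] at h2
      exact_mod_cast h2.symm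
  let z : ℕ → Fin (n + 1) → ℝ := fun i j => ((x i j - a j : ℤ) : ℝ)
  let u : Fin (n + 1) → ℝ := fun j => -2 * (a j : ℝ)
  have hch : IsCh u (Δ : ℝ) z N := by
    refine ⟨?_, ?_, ?_, ?_⟩
    · ext j; simp [z, h0]
    · intro i _ j; exact ⟨_, rfl⟩
    · intro i hi
      have h1 : (∑ j, (x i j : ℝ) ^ 2) = ∑ j, (a j : ℝ) ^ 2 := by exact_mod_cast hnorm i hi
      rw [← sub_eq_zero] at h1 ⊢
      rw [← h1]
      simp only [dotProduct, z, u]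
      rw [← Finset.sum_sub_distrib, ← Finset.sum_sub_distrib]
      apply Finset.sum_congr rfl
      intro j _
      push_cast; ring
    · intro i hi
      have h1 := (norm_le_znorm _).trans (hs i hi).symm.2
      have h2 : z (i + 1) - z i = fun j => (((x (i + 1) - x i) j : ℤ) : ℝ) := by
        ext j
        simp [z]
      rw [h2]
      exact h1
  have hb := H u Δ z N (by exact_mod_cast hΔ) hch
    ((Submodule.finrank_le _).trans (by simp))
  have hz : z N = fun j => ((b - a) j : ℝ) := by
    ext j; simp [z, hN]
  rw [hz] at hb
  rw [← neg_sub, znorm_neg]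
  calc _ ≤ _ := znorm_le_norm (b - a)
    _ ≤ ((n + 1 : ℕ) : ℝ) * (C * (Δ : ℝ) ^ E) := by gcongr
    _ = _ := by ring

theorem block_diameter_bound (d : ℕ) :
    ∃ C : ℝ, 0 < C ∧
      ∀ (Δ : ℕ) (a b : Fin d → ℤ),
        Relation.EqvGen
          (fun x y : Fin d → ℤ => znorm x = znorm y ∧ pd x y ≤ (Δ : ℝ)) a b →
        pd a b ≤ C * (Δ : ℝ) ^ (((d + 1).factorial : ℝ) / 2) := by
  obtain ⟨C, hC, H⟩ := rtg_bound d
  refine ⟨C, hC, fun Δ a b h => ?_⟩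
  rcases eqv_rtg h with h | h
  · exact (min_le_left _ _).trans (H Δ a b h)
  · have := H Δ a (-b) h
    rw [sub_neg_eq_add] at this
    exact (min_le_right _ _).trans this
end

section
/- Let A ⊂ Z^d be admissible with |A| = n, all elements of norm ≤ N, and let c ∈ R. Then for every k ∈ Z^A \ {0} and every κ > 0, the Lebesgue measure of {m ∈ [1,2] : |Σ_{a∈A} k_a ω_a(m) + c| ≤ κ} is at most C_n N^{4n^2} κ^{1/n} / |k|^{1/n}, where |k| = Σ_a |k_a| and ω_a(m) = sqrt(|a|^4+m), and C_n depends only on n. -/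
open MeasureTheory

/-- Sublevel set estimate on an order-connected set. -/
lemma sublevel_aux (j : ℕ) : ∀ (g : ℕ → ℝ → ℝ) (I : Set ℝ), I.OrdConnected →
    (∀ i, ∀ m ∈ I, HasDerivAt (g i) (g (i + 1) m) m) →
    ∀ (β t κ : ℝ), 0 < β → 0 < t → κ < β * t ^ j → (∀ m ∈ I, β ≤ g j m) →
    volume {m | m ∈ I ∧ |g 0 m| ≤ κ} ≤ ENNReal.ofReal ((4 ^ j - 1) * t) := by
  induction j with
  | zero =>
    intro g I hI hg β t κ hβ ht hκ hb
    have : {m | m ∈ I ∧ |g 0 m| ≤ κ} = ∅ := by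
      ext m
      simp only [Set.mem_ofPred_eq, Set.mem_empty_iff_false, iff_false, not_and, not_le]
      intro hm
      have := hb m hm
      have := le_abs_self (g 0 m)
      simp at hκ
      linarith
    rw [this]; simp
  | succ j ih =>
    intro g I hI hg β t κ hβ ht hκ hb
    have key : ∀ x ∈ I, ∀ y ∈ I, x ≤ y → β * (y - x) ≤ g j y - g j x := by
      intro x hx y hy hxy
      have hsub : Set.Icc x y ⊆ I := hI.out hx hy
      refine (convex_Icc x y).mul_sub_le_image_sub_of_le_deriv (f := g j) ?_ ?_ ?_ x
        (Set.left_mem_Icc.2 hxy) y (Set.right_mem_Icc.2 hxy) hxy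
      · intro z hz
        exact (hg j z (hsub hz)).continuousAt.continuousWithinAt
      · intro z hz
        exact (hg j z (hsub (interior_subset hz))).differentiableAt.differentiableWithinAt
      · intro z hz
        rw [(hg j z (hsub (interior_subset hz))).deriv]
        exact hb z (hsub (interior_subset hz))
    have mono : ∀ x ∈ I, ∀ y ∈ I, x ≤ y → g j x ≤ g j y := by
      intro x hx y hy hxy
      have := key x hx y hy hxy
      have : 0 ≤ β * (y - x) := mul_nonneg hβ.le (by linarith)
      linarith
    have hη : 0 < β * t := by positivity
    have hκ' : κ < (β * t) * t ^ j := by rw [mul_assoc, ← pow_succ']; exact hκ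
    -- upper piece
    have h1 := ih g {m | m ∈ I ∧ β * t ≤ g j m} ⟨by
        rintro x ⟨hx, hx'⟩ y ⟨hy, hy'⟩ z hz
        have hzI := hI.out hx hy hz
        exact ⟨hzI, hx'.trans (mono x hx z hzI hz.1)⟩⟩
      (fun i m hm => hg i m hm.1) (β * t) t κ hη ht hκ' (fun m hm => hm.2)
    have h2 := ih (fun i m => - g i m) {m | m ∈ I ∧ g j m ≤ - (β * t)} ⟨by
        rintro x ⟨hx, hx'⟩ y ⟨hy, hy'⟩ z hz
        have hzI := hI.out hx hy hz
        exact ⟨hzI, (mono z hzI y hy hz.2).trans hy'⟩⟩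
      (fun i m hm => (hg i m hm.1).neg) (β * t) t κ hη ht hκ' (fun m hm => by
        have := hm.2
        show β * t ≤ - g j m
        linarith)
    have h3 : volume {m | m ∈ I ∧ |g j m| < β * t} ≤ ENNReal.ofReal (2 * t) := by
      refine (Real.volume_le_diam _).trans ?_
      refine Metric.ediam_le ?_
      have aux : ∀ x y, x ≤ y → x ∈ {m | m ∈ I ∧ |g j m| < β * t} →
          y ∈ {m | m ∈ I ∧ |g j m| < β * t} → y - x ≤ 2 * t := by
        rintro x y hxy ⟨hx, hx'⟩ ⟨hy, hy'⟩
        have := key x hx y hy hxy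
        rw [abs_lt] at hx' hy'
        have : β * (y - x) ≤ β * (2 * t) := by linarith
        exact le_of_mul_le_mul_left this hβ
      intro x hx y hy
      rw [edist_dist]
      apply ENNReal.ofReal_le_ofReal
      rw [Real.dist_eq]
      rcases le_total x y with h | h
      · have := aux x y h hx hy
        rw [abs_le]; constructor <;> linarith
      · have := aux y x h hy hx
        rw [abs_le]; constructor <;> linarith
    have hsub : {m | m ∈ I ∧ |g 0 m| ≤ κ} ⊆
        ({m | m ∈ {m | m ∈ I ∧ β * t ≤ g j m} ∧ |g 0 m| ≤ κ} ∪
        {m | m ∈ {m | m ∈ I ∧ g j m ≤ - (β * t)} ∧ |(fun i m => - g i m) 0 m| ≤ κ}) ∪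
        {m | m ∈ I ∧ |g j m| < β * t} := by
      rintro m ⟨hm, hm'⟩
      by_cases ha : β * t ≤ g j m
      · exact Or.inl (Or.inl ⟨⟨hm, ha⟩, hm'⟩)
      by_cases hb' : g j m ≤ - (β * t)
      · exact Or.inl (Or.inr ⟨⟨hm, hb'⟩, by simpa using hm'⟩)
      · exact Or.inr ⟨hm, abs_lt.2 ⟨by linarith, by linarith⟩⟩
    have h4 : (1 : ℝ) ≤ 4 ^ j := one_le_pow₀ (by norm_num)
    calc _ ≤ _ := measure_mono hsub
      _ ≤ _ := measure_union_le _ _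
      _ ≤ _ := add_le_add (measure_union_le _ _) le_rfl
      _ ≤ _ := add_le_add (add_le_add h1 h2) h3
      _ ≤ _ := by
        rw [← ENNReal.ofReal_add (mul_nonneg (by linarith) ht.le) (mul_nonneg (by linarith) ht.le),
          ← ENNReal.ofReal_add (by nlinarith) (by linarith)]
        apply ENNReal.ofReal_le_ofReal
        rw [pow_succ]
        nlinarith

/-- Partition argument. -/
lemma sublevel_partition (n : ℕ) (g : ℕ → ℝ → ℝ)
    (hg : ∀ i, ∀ m ∈ Set.Icc (1:ℝ) 2, HasDerivAt (g i) (g (i + 1) m) m)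
    (β B κ : ℝ) (hn : 1 ≤ n) (hβ : 0 < β) (hβB : β ≤ B) (hκ : 0 < κ)
    (hB : ∀ j, 1 ≤ j → j ≤ n → ∀ m ∈ Set.Icc (1:ℝ) 2, |g (j+1) m| ≤ B)
    (hlow : ∀ m ∈ Set.Icc (1:ℝ) 2, ∃ j, 1 ≤ j ∧ j ≤ n ∧ β ≤ |g j m|) :
    volume {m | m ∈ Set.Icc (1:ℝ) 2 ∧ |g 0 m| ≤ κ} ≤
      ENNReal.ofReal (3 * B / β * 4 ^ n * (4 * κ / β) ^ ((1:ℝ) / n)) := by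
  set t := (4 * κ / β) ^ ((1:ℝ) / n) with ht
  have htpos : 0 < t := by positivity
  have htn : t ^ n = 4 * κ / β := by
    rw [ht, ← Real.rpow_natCast, ← Real.rpow_mul (by positivity)]
    rw [one_div_mul_cancel (by positivity)]; simp
  have hBβ : 1 ≤ B / β := (one_le_div hβ).2 hβB
  have h4n : (1 : ℝ) ≤ 4 ^ n := one_le_pow₀ (by norm_num)
  rcases lt_or_ge 1 t with h1t | h1t
  · calc _ ≤ volume (Set.Icc (1:ℝ) 2) := measure_mono (fun m hm => hm.1)
      _ = ENNReal.ofReal 1 := by rw [Real.volume_Icc]; norm_num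
      _ ≤ _ := by
        apply ENNReal.ofReal_le_ofReal
        have : 1 ≤ 3 * B / β := by rw [mul_div_assoc]; linarith
        have : 1 ≤ 3 * B / β * 4 ^ n := one_le_mul_of_one_le_of_one_le this h4n
        exact one_le_mul_of_one_le_of_one_le this h1t.le
  · set M := ⌈2 * B / β⌉₊ with hM
    have hM1 : 2 * B / β ≤ M := Nat.le_ceil _
    have hM2 : (M : ℝ) ≤ 3 * B / β := by
      have := (Nat.ceil_lt_add_one (a := 2 * B / β) (by rw [mul_div_assoc]; positivity)).le
      rw [← hM] at this
      have e1 : 2 * B / β = 2 * (B / β) := mul_div_assoc _ _ _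
      have e2 : 3 * B / β = 3 * (B / β) := mul_div_assoc _ _ _
      linarith
    have hMpos : (0:ℝ) < M := lt_of_lt_of_le (by rw [mul_div_assoc]; positivity) hM1
    have hBM : B / M ≤ β / 2 := by
      rw [div_le_iff₀ hMpos]
      rw [div_le_iff₀ hβ] at hM1
      linarith
    let J : ℕ → Set ℝ := fun i => Set.Icc (1 + i / M : ℝ) (1 + (i + 1) / M)
    have hJsub : ∀ i ∈ Finset.range M, J i ⊆ Set.Icc (1:ℝ) 2 := by
      intro i hi
      apply Set.Icc_subset_Icc
      · have : (0:ℝ) ≤ i / M := by positivity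
        linarith
      · have : ((i:ℝ) + 1) / M ≤ 1 := by
          rw [div_le_one hMpos]; exact_mod_cast Finset.mem_range.1 hi
        linarith
    have hpiece : ∀ i ∈ Finset.range M, volume {m | m ∈ J i ∧ |g 0 m| ≤ κ} ≤
        ENNReal.ofReal (4 ^ n * t) := by
      intro i hi
      have hl : (1 + i / M : ℝ) ∈ J i := by
        refine Set.left_mem_Icc.2 ?_
        gcongr; linarith
      obtain ⟨j, hj1, hjn, hj⟩ := hlow _ (hJsub i hi hl)
      have hlip : ∀ m ∈ J i, |g j m - g j (1 + i / M)| ≤ β / 2 := by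
        intro m hm
        have := (convex_Icc (1 + i / M : ℝ) (1 + (i + 1) / M)).norm_image_sub_le_of_norm_hasDerivWithin_le
          (f := g j) (f' := g (j+1)) (C := B)
          (fun z hz => (hg j z (hJsub i hi hz)).hasDerivWithinAt)
          (fun z hz => hB j hj1 hjn z (hJsub i hi hz)) hl hm
        rw [Real.norm_eq_abs, Real.norm_eq_abs] at this
        refine this.trans (le_trans ?_ hBM)
        rw [div_eq_mul_one_div B]
        have hB0 : 0 ≤ B := by linarith
        gcongr
        have h1 := hm.1
        have h2 := hm.2
        rw [add_div] at h2
        rw [abs_le]; constructor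
        · have : 0 < 1 / (M:ℝ) := by positivity
          linarith
        · linarith
      have htj : κ < β / 2 * t ^ j := by
        have : t ^ n ≤ t ^ j := pow_le_pow_of_le_one htpos.le h1t hjn
        rw [htn] at this
        calc κ < β / 2 * (4 * κ / β) := by field_simp; linarith
          _ ≤ _ := by gcongr
      have hfin : ENNReal.ofReal ((4 ^ j - 1) * t) ≤ ENNReal.ofReal (4 ^ n * t) := by
        apply ENNReal.ofReal_le_ofReal
        have : (4:ℝ) ^ j ≤ 4 ^ n := pow_le_pow_right₀ (by norm_num) hjn
        gcongr; linarith
      rcases le_abs.1 hj with hpos | hneg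
      · refine (sublevel_aux j g (J i) Set.ordConnected_Icc (fun i' m hm => hg i' m (hJsub i hi hm))
          (β / 2) t κ (by positivity) htpos htj ?_).trans hfin
        intro m hm
        have := (abs_le.1 (hlip m hm)).1
        linarith
      · have := (sublevel_aux j (fun i m => - g i m) (J i) Set.ordConnected_Icc
          (fun i' m hm => (hg i' m (hJsub i hi hm)).neg)
          (β / 2) t κ (by positivity) htpos htj ?_).trans hfin
        · simpa only [abs_neg] using this
        intro m hm
        have := (abs_le.1 (hlip m hm)).2
        show β / 2 ≤ - g j m
        linarith
    have hcov : {m | m ∈ Set.Icc (1:ℝ) 2 ∧ |g 0 m| ≤ κ} ⊆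
        ⋃ i ∈ Finset.range M, {m | m ∈ J i ∧ |g 0 m| ≤ κ} := by
      rintro m ⟨hm, hm'⟩
      simp only [Set.mem_iUnion]
      have hMn : 0 < M := by exact_mod_cast hMpos
      rcases eq_or_lt_of_le hm.2 with h2 | h2
      · refine ⟨M - 1, Finset.mem_range.2 (by omega), ⟨?_, ?_⟩, hm'⟩
        · rw [h2]
          have : ((M - 1 : ℕ) : ℝ) / M ≤ 1 := by
            rw [div_le_one hMpos]; exact_mod_cast Nat.sub_le _ _
          linarith
        · rw [h2, Nat.cast_sub hMn]
          have : (((M:ℝ) - (1:ℕ)) + 1) / M = 1 := by field_simp; push_cast; ring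
          linarith
      · have h0 : 0 ≤ (m - 1) * M := mul_nonneg (by linarith [hm.1]) hMpos.le
        refine ⟨⌊(m - 1) * M⌋₊, Finset.mem_range.2 ?_, ⟨?_, ?_⟩, hm'⟩
        · rw [Nat.floor_lt h0]
          nlinarith
        · have := Nat.floor_le h0
          have : (⌊(m - 1) * M⌋₊ : ℝ) / M ≤ m - 1 := by rwa [div_le_iff₀ hMpos]
          linarith
        · have := (Nat.lt_floor_add_one ((m - 1) * M)).le
          have : m - 1 ≤ ((⌊(m - 1) * M⌋₊ : ℝ) + 1) / M := by rwa [le_div_iff₀ hMpos]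
          linarith
    calc _ ≤ _ := measure_mono hcov
      _ ≤ _ := measure_biUnion_finset_le _ _
      _ ≤ ∑ i ∈ Finset.range M, ENNReal.ofReal (4 ^ n * t) := Finset.sum_le_sum hpiece
      _ = ENNReal.ofReal (M * (4 ^ n * t)) := by
        rw [Finset.sum_const, Finset.card_range, nsmul_eq_mul, ENNReal.ofReal_mul (by positivity)]
        simp
      _ ≤ _ := by
        apply ENNReal.ofReal_le_ofReal
        rw [mul_assoc (3 * B / β)]
        gcongr

/-- Interpolation. -/
lemma interp_aux {ι : Type*} [DecidableEq ι] (A : Finset ι) (w z : ι → ℝ) (n : ℕ) (ε : ℝ)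
    (hz : ∀ b ∈ A, |z b| ≤ 1)
    (h : ∀ j, 1 ≤ j → j ≤ n → |∑ b ∈ A, w b * z b ^ j| ≤ ε) (S : Finset ι) (hS : S ⊆ A) :
    ∀ j, 1 ≤ j → j + S.card ≤ n →
      |∑ b ∈ A, w b * z b ^ j * ∏ s ∈ S, (z b - z s)| ≤ 2 ^ S.card * ε := by
  induction S using Finset.induction_on with
  | empty =>
    intro j h1 h2
    simpa using h j h1 (by simpa using h2)
  | insert s S hs ih =>
    intro j h1 h2
    rw [Finset.card_insert_of_notMem hs] at h2 ⊢
    have ih' := ih ((Finset.subset_insert _ _).trans hS)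
    have e : ∑ b ∈ A, w b * z b ^ j * ∏ s ∈ insert s S, (z b - z s) =
        (∑ b ∈ A, w b * z b ^ (j+1) * ∏ s ∈ S, (z b - z s)) -
        z s * ∑ b ∈ A, w b * z b ^ j * ∏ s ∈ S, (z b - z s) := by
      rw [Finset.mul_sum, ← Finset.sum_sub_distrib]
      refine Finset.sum_congr rfl fun b _ => ?_
      rw [Finset.prod_insert hs]; ring
    rw [e]
    have a1 := ih' (j+1) (by omega) (by omega)
    have a2 := ih' j h1 (by omega)
    have hzs := hz s (hS (Finset.mem_insert_self _ _))
    refine (abs_sub _ _).trans ?_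
    rw [abs_mul]
    have := mul_le_mul hzs a2 (abs_nonneg _) zero_le_one
    rw [pow_succ]; linarith

lemma interp {ι : Type*} [DecidableEq ι] (A : Finset ι) (w z : ι → ℝ) (ε : ℝ)
    (hz : ∀ b ∈ A, |z b| ≤ 1)
    (h : ∀ j, 1 ≤ j → j ≤ A.card → |∑ b ∈ A, w b * z b ^ j| ≤ ε) (a : ι) (ha : a ∈ A) :
    |w a * z a| * ∏ s ∈ A.erase a, |z a - z s| ≤ 2 ^ (A.card - 1) * ε := by
  have hc : 0 < A.card := Finset.card_pos.2 ⟨a, ha⟩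
  have := interp_aux A w z A.card ε hz h (A.erase a) (Finset.erase_subset _ _) 1 le_rfl
    (by rw [Finset.card_erase_of_mem ha]; omega)
  rw [Finset.card_erase_of_mem ha, Finset.sum_eq_single a] at this
  · rwa [abs_mul, Finset.abs_prod, pow_one] at this
  · intro b hb hba
    rw [Finset.prod_eq_zero (Finset.mem_erase.2 ⟨hba, hb⟩) (sub_self _), mul_zero]
  · intro h; exact absurd ha h

/-- Derivative family of the phase. -/
noncomputable def phaseDer {ι : Type*} (A : Finset ι) (k x : ι → ℝ) (c : ℝ) (j : ℕ) (m : ℝ) : ℝ :=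
  (∏ i ∈ Finset.range j, ((1:ℝ) / 2 - i)) * ∑ a ∈ A, k a * (x a + m) ^ ((1:ℝ) / 2 - j) +
    if j = 0 then c else 0

lemma phaseDer_hasDerivAt {ι : Type*} (A : Finset ι) (k x : ι → ℝ) (c : ℝ)
    (hx : ∀ a ∈ A, 0 ≤ x a) (j : ℕ) (m : ℝ) (hm : 1 ≤ m) :
    HasDerivAt (phaseDer A k x c j) (phaseDer A k x c (j + 1) m) m := by
  have h1 : HasDerivAt (fun m => ∑ a ∈ A, k a * (x a + m) ^ ((1:ℝ) / 2 - j))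
      (∑ a ∈ A, k a * (((1:ℝ) / 2 - j) * (x a + m) ^ ((1:ℝ) / 2 - j - 1))) m := by
    apply HasDerivAt.fun_sum
    intro a ha
    apply HasDerivAt.const_mul
    have h0 : HasDerivAt (fun m => x a + m) 1 m := (hasDerivAt_id m).const_add (x a)
    have := h0.rpow_const (p := (1:ℝ) / 2 - j) (Or.inl (by have := hx a ha; linarith))
    simpa using this
  have h2 := (h1.const_mul (∏ i ∈ Finset.range j, ((1:ℝ) / 2 - i))).add_const
    (if j = 0 then c else 0)
  have e : phaseDer A k x c (j + 1) m = (∏ i ∈ Finset.range j, ((1:ℝ) / 2 - i)) *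
      (∑ a ∈ A, k a * (((1:ℝ) / 2 - j) * (x a + m) ^ ((1:ℝ) / 2 - j - 1))) := by
    unfold phaseDer
    rw [Finset.prod_range_succ, if_neg (Nat.succ_ne_zero j), add_zero, mul_assoc]
    congr 1
    rw [Finset.mul_sum]
    refine Finset.sum_congr rfl fun a _ => ?_
    rw [show (1:ℝ) / 2 - ((j + 1 : ℕ) : ℝ) = 1 / 2 - j - 1 by push_cast; ring]
    ring
  rw [e]
  exact h2

lemma coef_upper (j : ℕ) : |∏ i ∈ Finset.range j, ((1:ℝ) / 2 - i)| ≤ (j.factorial : ℝ) := by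
  induction j with
  | zero => simp
  | succ j ih =>
    rw [Finset.prod_range_succ, abs_mul, Nat.factorial_succ, mul_comm]
    push_cast
    have hj : (0:ℝ) ≤ j := Nat.cast_nonneg j
    have : |(1:ℝ) / 2 - j| ≤ j + 1 := by rw [abs_le]; constructor <;> linarith
    gcongr

lemma coef_lower (j : ℕ) : ((1:ℝ) / 2) ^ j ≤ |∏ i ∈ Finset.range j, ((1:ℝ) / 2 - i)| := by
  induction j with
  | zero => simp
  | succ j ih =>
    rw [Finset.prod_range_succ, abs_mul, pow_succ]
    have : (1:ℝ) / 2 ≤ |(1:ℝ) / 2 - j| := by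
      rcases Nat.eq_zero_or_pos j with h | h
      · subst h; simp
      · have : (1:ℝ) ≤ j := by exact_mod_cast h
        rw [le_abs]; right; linarith
    gcongr

lemma phaseDer_upper {ι : Type*} (A : Finset ι) (k x : ι → ℝ) (c : ℝ)
    (hx : ∀ a ∈ A, 0 ≤ x a) (j n : ℕ) (hj : 1 ≤ j) (hjn : j ≤ n + 1) (m : ℝ) (hm : 1 ≤ m) :
    |phaseDer A k x c j m| ≤ ((n + 1).factorial : ℝ) * ∑ a ∈ A, |k a| := by
  unfold phaseDer
  rw [if_neg (by omega), add_zero, abs_mul]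
  have h1 : (j.factorial : ℝ) ≤ ((n+1).factorial : ℝ) := by
    exact_mod_cast Nat.factorial_le hjn
  have h2 : |∑ a ∈ A, k a * (x a + m) ^ ((1:ℝ) / 2 - j)| ≤ ∑ a ∈ A, |k a| := by
    refine (Finset.abs_sum_le_sum_abs _ _).trans (Finset.sum_le_sum fun a ha => ?_)
    rw [abs_mul]
    have h3 : 1 ≤ x a + m := by have := hx a ha; linarith
    have h4 : (1:ℝ) ≤ j := by exact_mod_cast hj
    rw [abs_of_nonneg (Real.rpow_nonneg (by linarith) _)]
    exact mul_le_of_le_one_right (abs_nonneg _) (Real.rpow_le_one_of_one_le_of_nonpos h3 (by linarith))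
  exact mul_le_mul ((coef_upper j).trans h1) h2 (abs_nonneg _) (by positivity)

lemma phaseDer_lower {ι : Type*} [DecidableEq ι] (A : Finset ι) (k x : ι → ℝ) (c N : ℝ)
    (hN : 1 ≤ N) (hx : ∀ a ∈ A, 0 ≤ x a) (hxN : ∀ a ∈ A, x a ≤ N ^ 4)
    (hsep : ∀ a ∈ A, ∀ b ∈ A, a ≠ b → 1 ≤ |x a - x b|)
    (hk : 0 < ∑ a ∈ A, |k a|) (m : ℝ) (hm : m ∈ Set.Icc (1:ℝ) 2) :
    ∃ j, 1 ≤ j ∧ j ≤ A.card ∧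
      (∑ a ∈ A, |k a|) / (3 * A.card * 36 ^ A.card * N ^ (2 + 8 * (A.card - 1))) ≤
        |phaseDer A k x c j m| := by
  by_contra! hcon
  set n := A.card with hn
  set K := ∑ a ∈ A, |k a| with hK
  have hne : A.Nonempty := by
    rw [Finset.nonempty_iff_ne_empty]; rintro rfl; simp [K] at hk
  have hnpos : 0 < n := Finset.card_pos.2 hne
  obtain ⟨hm1, hm2⟩ := hm
  have hN4 : (1:ℝ) ≤ N ^ 4 := one_le_pow₀ hN
  have hy1 : ∀ a ∈ A, 1 ≤ x a + m := fun a ha => by have := hx a ha; linarith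
  have hy2 : ∀ a ∈ A, x a + m ≤ 3 * N ^ 4 := fun a ha => by have := hxN a ha; linarith
  obtain ⟨a, ha, hka⟩ : ∃ a ∈ A, K / n ≤ |k a| := by
    apply Finset.exists_le_of_sum_le hne
    rw [Finset.sum_const, nsmul_eq_mul, ← hn, ← hK]
    exact le_of_eq (by field_simp)
  let z : ι → ℝ := fun b => (x b + m)⁻¹
  let w : ι → ℝ := fun b => k b * (x b + m) ^ ((1:ℝ) / 2)
  set ε := K / (3 * n * 18 ^ n * N ^ (2 + 8 * (n - 1))) with hε
  have hεpos : 0 < ε := by positivity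
  have hz : ∀ b ∈ A, |z b| ≤ 1 := by
    intro b hb
    have := hy1 b hb
    rw [abs_of_nonneg (by positivity)]
    exact inv_le_one_of_one_le₀ this
  have hmom : ∀ j, 1 ≤ j → j ≤ A.card → |∑ b ∈ A, w b * z b ^ j| ≤ ε := by
    intro j hj1 hjn
    have h1 := hcon j hj1 hjn
    unfold phaseDer at h1
    rw [if_neg (by omega), add_zero, abs_mul] at h1
    have e : ∑ b ∈ A, w b * z b ^ j = ∑ a ∈ A, k a * (x a + m) ^ ((1:ℝ) / 2 - j) := by
      refine Finset.sum_congr rfl fun b hb => ?_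
      have := hy1 b hb
      rw [Real.rpow_sub (by linarith), Real.rpow_natCast]
      simp only [w, z, inv_pow]
      ring
    rw [e]
    have h2 := coef_lower j
    have h3 : ((1:ℝ)/2) ^ n ≤ (1/2) ^ j := pow_le_pow_of_le_one (by norm_num) (by norm_num) hjn
    have h4 : ((1:ℝ)/2) ^ n * |∑ a ∈ A, k a * (x a + m) ^ ((1:ℝ) / 2 - j)| ≤ (1/2) ^ n * ε := by
      refine (mul_le_mul_of_nonneg_right (h3.trans h2) (abs_nonneg _)).trans (h1.le.trans ?_)
      apply le_of_eq
      rw [hε, show (36:ℝ) = 2 * 18 by norm_num, mul_pow, div_pow, one_pow]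
      field_simp
    exact le_of_mul_le_mul_left h4 (by positivity)
  have hfin := interp A w z ε hz hmom a ha
  have hwz : K / n * (1 / (3 * N ^ 2)) ≤ |w a * z a| := by
    have hy := hy1 a ha
    have hsq : w a * z a = k a / Real.sqrt (x a + m) := by
      simp only [w, z]
      rw [← Real.sqrt_eq_rpow]
      have hs : 0 < Real.sqrt (x a + m) := Real.sqrt_pos.2 (by linarith)
      have h2 := Real.mul_self_sqrt (show 0 ≤ x a + m by linarith)
      rw [eq_div_iff hs.ne', mul_assoc, mul_assoc, mul_comm (x a + m)⁻¹, ← mul_assoc (√(x a + m)),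
        h2, mul_inv_cancel₀ (by linarith), mul_one]
    rw [hsq, abs_div, div_eq_mul_one_div |k a|]
    have hs : 0 < Real.sqrt (x a + m) := Real.sqrt_pos.2 (by linarith)
    rw [abs_of_pos hs]
    have : Real.sqrt (x a + m) ≤ 3 * N ^ 2 := by
      rw [Real.sqrt_le_left (by positivity)]
      have := hy2 a ha
      nlinarith
    gcongr
  have hprod : (1 / (9 * N ^ 8)) ^ (n - 1) ≤ ∏ s ∈ A.erase a, |z a - z s| := by
    rw [hn, ← Finset.card_erase_of_mem ha]
    rw [← Finset.prod_const]
    apply Finset.prod_le_prod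
    · intro i _; positivity
    intro b hb
    obtain ⟨hba, hb⟩ := Finset.mem_erase.1 hb
    have h1 := hy1 a ha
    have h2 := hy1 b hb
    have e : z a - z b = (x b - x a) / ((x a + m) * (x b + m)) := by
      simp only [z]
      have : x a + m ≠ 0 := by linarith
      have : x b + m ≠ 0 := by linarith
      field_simp
      ring
    rw [e, abs_div, abs_of_pos (show 0 < (x a + m) * (x b + m) by positivity)]
    have h3 : (x a + m) * (x b + m) ≤ 9 * N ^ 8 := by
      calc _ ≤ (3 * N ^ 4) * (3 * N ^ 4) :=
            mul_le_mul (hy2 a ha) (hy2 b hb) (by linarith) (by positivity)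
        _ = _ := by ring
    have h4 := hsep b hb a ha hba
    exact div_le_div₀ (abs_nonneg _) h4 (by positivity) h3
  have hlow : K / n * (1 / (3 * N ^ 2)) * (1 / (9 * N ^ 8)) ^ (n - 1) ≤ 2 ^ (n - 1) * ε :=
    (mul_le_mul hwz hprod (by positivity) (abs_nonneg _)).trans hfin
  have hlt : 2 ^ (n - 1) * ε < K / n * (1 / (3 * N ^ 2)) * (1 / (9 * N ^ 8)) ^ (n - 1) := by
    obtain ⟨p, hp⟩ : ∃ p, n = p + 1 := ⟨n - 1, by omega⟩
    have e1 : n - 1 = p := by omega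
    have e2 : (18:ℝ) ^ n = 18 * (2 ^ p * 9 ^ p) := by
      rw [hp, pow_succ, ← mul_pow]; norm_num; ring
    rw [hε, e1, e2, pow_add, pow_mul, div_pow, one_pow, mul_pow]
    have hn' : (0:ℝ) < n := by exact_mod_cast hnpos
    have : 2 ^ p * (K / (3 * n * (18 * (2 ^ p * 9 ^ p)) * (N ^ 2 * (N ^ 8) ^ p))) =
      1 / 18 * (K / n * (1 / (3 * N ^ 2)) * (1 / (9 ^ p * (N ^ 8) ^ p))) := by
      field_simp
    rw [this]
    have hN0 : 0 < N := by linarith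
    have h9 : 0 < 1 / (9 ^ p * (N ^ 8) ^ p) := one_div_pos.2 (mul_pos (pow_pos (by norm_num) _)
      (pow_pos (pow_pos hN0 _) _))
    have h10 : 0 < K / n * (1 / (3 * N ^ 2)) := mul_pos (div_pos hk hn') (by positivity)
    have := mul_pos h10 h9
    linarith
  linarith

lemma znorm_pow_four {d : ℕ} (a : Fin d → ℤ) :
    znorm a ^ 4 = (((∑ i, a i ^ 2) ^ 2 : ℤ) : ℝ) := by
  unfold znorm
  have h : (0:ℝ) ≤ ∑ i, ((a i : ℝ)) ^ 2 := Finset.sum_nonneg fun i _ => sq_nonneg _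
  rw [show 4 = 2 * 2 by rfl, pow_mul, Real.sq_sqrt h]
  push_cast; rfl

lemma power_count (n : ℕ) (hn : 1 ≤ n) (N : ℝ) (hN : 1 ≤ N) :
    N ^ (2 + 8 * (n - 1)) * (N ^ (2 + 8 * (n - 1))) ^ ((1:ℝ) / n) ≤ N ^ (4 * n ^ 2) := by
  have hN0 : 0 < N := by linarith
  rw [← Real.rpow_natCast N (2 + 8 * (n - 1)), ← Real.rpow_natCast N (4 * n ^ 2),
    ← Real.rpow_mul hN0.le, ← Real.rpow_add hN0]
  apply Real.rpow_le_rpow_of_exponent_le hN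
  push_cast [Nat.cast_sub hn]
  have hn' : (0:ℝ) < n := by exact_mod_cast hn
  have key : (2 + 8 * ((n:ℝ) - 1)) * (n + 1) ≤ 4 * n ^ 2 * n := by
    rcases Nat.lt_or_ge n 3 with h | h
    · interval_cases n <;> norm_num
    · have : (3:ℝ) ≤ n := by exact_mod_cast h
      nlinarith [mul_nonneg (sub_nonneg.2 this) (sq_nonneg (n:ℝ))]
  have e : 2 + 8 * ((n:ℝ) - 1) + (2 + 8 * (n - 1)) * (1 / n) = (2 + 8 * ((n:ℝ) - 1)) * (n + 1) / n := by
    field_simp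
  rw [e, div_le_iff₀ hn']
  exact key

theorem nonresonance_measure_estimate (n : ℕ) (hn : 1 ≤ n) :
    ∃ C : ℝ, 0 < C ∧
      ∀ (d : ℕ) (A : Finset (Fin d → ℤ)), A.card = n →
        (∀ a ∈ A, ∀ b ∈ A, a ≠ b → znorm a ≠ znorm b) →
        ∀ N : ℝ, 1 ≤ N → (∀ a ∈ A, znorm a ≤ N) →
        ∀ k : (Fin d → ℤ) → ℤ, (∃ a ∈ A, k a ≠ 0) →
        ∀ (c : ℝ) (κ : ℝ), 0 < κ →
          volume {m : ℝ | m ∈ Set.Icc (1 : ℝ) 2 ∧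
              |∑ a ∈ A, (k a : ℝ) * Real.sqrt (znorm a ^ 4 + m) + c| ≤ κ} ≤
            ENNReal.ofReal
              (C * N ^ (4 * n ^ 2) * κ ^ ((1 : ℝ) / n) /
                (∑ a ∈ A, |(k a : ℝ)|) ^ ((1 : ℝ) / n)) := by
  have hn' : (0:ℝ) < n := by exact_mod_cast hn
  set D : ℝ := 3 * n * 36 ^ n with hD
  have hDpos : 0 < D := by positivity
  refine ⟨3 * ((n+1).factorial : ℝ) * D * 4 ^ n * (4 * D) ^ ((1:ℝ) / n), by positivity, ?_⟩
  intro d A hA hdist N hN hAN k hk c κ hκ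
  set K := ∑ a ∈ A, |(k a : ℝ)| with hK
  have hKpos : 0 < K := by
    obtain ⟨a, ha, hka⟩ := hk
    refine Finset.sum_pos' (fun _ _ => abs_nonneg _) ⟨a, ha, ?_⟩
    exact abs_pos.2 (by exact_mod_cast hka)
  let x : (Fin d → ℤ) → ℝ := fun a => znorm a ^ 4
  have hz0 : ∀ a : Fin d → ℤ, 0 ≤ znorm a := fun a => Real.sqrt_nonneg _
  have hx : ∀ a ∈ A, 0 ≤ x a := fun a _ => pow_nonneg (hz0 a) 4
  have hxN : ∀ a ∈ A, x a ≤ N ^ 4 := fun a ha => pow_le_pow_left₀ (hz0 a) (hAN a ha) 4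
  have hsep : ∀ a ∈ A, ∀ b ∈ A, a ≠ b → 1 ≤ |x a - x b| := by
    intro a ha b hb hab
    have hne : x a ≠ x b := by
      intro h
      exact hdist a ha b hb hab ((pow_left_inj₀ (hz0 a) (hz0 b) (by norm_num)).1 h)
    simp only [x, znorm_pow_four] at hne ⊢
    have : (∑ i, a i ^ 2) ^ 2 ≠ (∑ i, b i ^ 2) ^ 2 := by exact_mod_cast hne
    have := Int.one_le_abs (sub_ne_zero.2 this)
    exact_mod_cast this
  set L := N ^ (2 + 8 * (n - 1)) with hL
  have hL1 : 1 ≤ L := one_le_pow₀ hN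
  have hlow := fun m hm => phaseDer_lower A (fun a => (k a : ℝ)) x c N hN hx hxN hsep hKpos m hm
  rw [hA] at hlow
  have hf1 : (1:ℝ) ≤ ((n+1).factorial : ℝ) := by exact_mod_cast Nat.succ_le_of_lt (Nat.factorial_pos _)
  have hD1 : 1 ≤ D := by
    have h1 : (1:ℝ) ≤ n := by exact_mod_cast hn
    have h2 : (1:ℝ) ≤ 36 ^ n := one_le_pow₀ (by norm_num)
    nlinarith
  have hβB : K / (D * L) ≤ ((n+1).factorial : ℝ) * K := by
    rw [div_le_iff₀ (by positivity)]
    have : 1 ≤ ((n+1).factorial : ℝ) * (D * L) :=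
      one_le_mul_of_one_le_of_one_le hf1 (one_le_mul_of_one_le_of_one_le hD1 hL1)
    nlinarith
  have main := sublevel_partition n (phaseDer A (fun a => (k a : ℝ)) x c)
    (fun i m hm => phaseDer_hasDerivAt A _ x c hx i m hm.1)
    (K / (D * L)) (((n+1).factorial : ℝ) * K) κ hn (by positivity) hβB hκ
    (fun j hj hjn m hm => phaseDer_upper A _ x c hx (j+1) n (by omega) (by omega) m hm.1)
    hlow
  have hset : {m : ℝ | m ∈ Set.Icc (1 : ℝ) 2 ∧
      |∑ a ∈ A, (k a : ℝ) * Real.sqrt (znorm a ^ 4 + m) + c| ≤ κ} =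
      {m | m ∈ Set.Icc (1:ℝ) 2 ∧ |phaseDer A (fun a => (k a : ℝ)) x c 0 m| ≤ κ} := by
    ext m
    simp [phaseDer, Real.sqrt_eq_rpow, x]
  rw [hset]
  refine main.trans (ENNReal.ofReal_le_ofReal ?_)
  have hpc := power_count n hn N hN
  rw [← hL] at hpc
  have e1 : 4 * κ / (K / (D * L)) = (4 * D) * L * κ / K := by field_simp
  rw [e1, Real.div_rpow (by positivity) hKpos.le, Real.mul_rpow (by positivity) hκ.le,
    Real.mul_rpow (by positivity) (by positivity)]
  have e2 : 3 * (((n+1).factorial : ℝ) * K) / (K / (D * L)) = 3 * ((n+1).factorial : ℝ) * D * L := by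
    field_simp
  rw [e2]
  calc _ = 3 * ((n+1).factorial : ℝ) * D * 4 ^ n * (4 * D) ^ ((1:ℝ) / n) *
        (L * L ^ ((1:ℝ) / n)) * κ ^ ((1 : ℝ) / n) / K ^ ((1:ℝ) / n) := by ring
    _ ≤ _ := by gcongr
end
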